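/- arXiv:2605.19904 — 2 statements merged into one kernel-verified Lean document; each statement's English description precedes it below -/
import Mathlib

section
/- Let S be a nonempty finite word over the alphabet [m] and let S' be the reversal of S. Then E(S') = E(S). -/
/-- The probability of a given finite word over the alphabet `Fin m`, where face `i`
has probability `p i`. -/
def dieP {m : ℕ} (p : Fin m → ℝ) (w : List (Fin m)) : ℝ := (w.map p).prod

/-- The number of occurrences of `S` as a factor (consecutive subword) of `w`. -/
def numOccs {m : ℕ} (S w : List (Fin m)) : ℕ :=
  ((Finset.range (w.length + 1)).filter fun i => (w.drop i).take S.length = S).card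

/-- `dieZ S` is the set of finite words over `Fin m` in which `S` occurs exactly once
as a factor, namely as a suffix. -/
def dieZ {m : ℕ} (S : List (Fin m)) : Set (List (Fin m)) := {w | S <:+ w ∧ numOccs S w = 1}

/-- The lengths, shifted down by one, of the overlaps of `S`, i.e. of the nonempty words
that are simultaneously a prefix and a suffix of `S`.  The overlap of `S` of length
`i + 1` (for `i ∈ overlapLens S`) is `S.take (i + 1)`, so that summation over the set of
overlaps of `S` is summation of `S.take (i + 1)` over `i ∈ overlapLens S`. -/
def overlapLens {m : ℕ} (S : List (Fin m)) : Finset ℕ :=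
  (Finset.range S.length).filter fun i => S.take (i + 1) <:+ S

/-- The expected number of die rolls `E(S) = ∑_{w ∈ Z(S)} |w| P(w)` needed to produce `S`. -/
noncomputable def dieE {m : ℕ} (p : Fin m → ℝ) (S : List (Fin m)) : ℝ :=
  ∑' w : dieZ S, (w.1.length : ℝ) * dieP p w.1

/-- A word lies in `dieZ S` iff it contains `S` as a factor but stops doing so once its last
letter is removed. -/
theorem mem_dieZ_iff {m : ℕ} {S : List (Fin m)} (hS : S ≠ []) (w : List (Fin m)) :
    w ∈ dieZ S ↔ S <:+: w ∧ ¬ S <:+: w.dropLast := by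
  have hpos : 0 < S.length := List.length_pos_iff.2 hS
  have hsuff (h : S <:+ w) : w.length - S.length ∈
      (Finset.range (w.length + 1)).filter fun i => (w.drop i).take S.length = S := by
    obtain ⟨a, rfl⟩ := h
    simp
  constructor
  · rintro ⟨hs, h1⟩
    refine ⟨hs.isInfix, ?_⟩
    rintro ⟨a, b, hab⟩
    have hw : w ≠ [] := by
      rintro rfl
      exact hS (List.suffix_nil.1 hs)
    have hw' : w = a ++ S ++ b ++ [w.getLast hw] := by
      rw [hab, List.dropLast_append_getLast]
    have hlen := congrArg List.length hw'
    simp only [List.length_append, List.length_singleton] at hlen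
    have ha : a.length ∈
        (Finset.range (w.length + 1)).filter fun i => (w.drop i).take S.length = S := by
      rw [Finset.mem_filter, Finset.mem_range]
      refine ⟨by omega, ?_⟩
      rw [hw']
      simp
    have := Finset.card_le_one.1 (le_of_eq h1) _ ha _ (hsuff hs)
    omega
  · rintro ⟨hi, hd⟩
    have hocc (a b : List (Fin m)) (hab : a ++ S ++ b = w) : b = [] := by
      by_contra hb
      apply hd
      rw [← hab, List.dropLast_append_of_ne_nil hb]
      exact ⟨a, b.dropLast, rfl⟩
    have hs : S <:+ w := by
      obtain ⟨a, b, hab⟩ := hi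
      have hb := hocc a b hab
      subst hb
      exact ⟨a, by simpa using hab⟩
    refine ⟨hs, Finset.card_eq_one.2 ⟨w.length - S.length, ?_⟩⟩
    refine Finset.eq_singleton_iff_unique_mem.2 ⟨hsuff hs, fun i hi => ?_⟩
    have h := (Finset.mem_filter.1 hi).2
    have hw : w.take i ++ S ++ (w.drop i).drop S.length = w := by
      conv_lhs => rw [← h]
      simp only [List.length_take, List.length_drop]
      conv_rhs => rw [← List.take_append_drop i w, ← List.take_append_drop S.length (w.drop i)]
      have hl := congrArg List.length h
      simp only [List.length_take, List.length_drop] at hl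
      rw [hl, List.append_assoc]
    have hl := congrArg List.length (hocc _ _ hw)
    have hl' := congrArg List.length h
    simp only [List.length_take, List.length_drop, List.length_nil] at hl hl'
    omega

open scoped Classical ENNReal in
/-- The total weight of the words of length `n` satisfying `C`. -/
noncomputable def lengthWeight {m : ℕ} (q : Fin m → ℝ≥0∞) (C : List (Fin m) → Prop) (n : ℕ) :
    ℝ≥0∞ :=
  ∑' w : List (Fin m), if w.length = n ∧ C w then (w.map q).prod else 0

open scoped ENNReal

section lengthWeight

variable {m : ℕ} {q : Fin m → ℝ≥0∞}

theorem lengthWeight_reverse (C : List (Fin m) → Prop) (n : ℕ) :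
    lengthWeight q (fun w => C w.reverse) n = lengthWeight q C n := by
  classical
  unfold lengthWeight
  rw [← (List.reverse_involutive (α := Fin m)).toPerm.tsum_eq]
  refine tsum_congr fun w => ?_
  simp [List.map_reverse, List.prod_reverse]

theorem lengthWeight_zero_le (C : List (Fin m) → Prop) : lengthWeight q C 0 ≤ 1 := by
  classical
  unfold lengthWeight
  rw [tsum_eq_single []]
  · simp only [List.map_nil, List.prod_nil]
    split_ifs <;> simp
  · intro w hw
    simp [hw]

theorem lengthWeight_succ_dropLast (hq : ∑ i, q i = 1) (C : List (Fin m) → Prop) (n : ℕ) :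
    lengthWeight q (fun w => C w.dropLast) (n + 1) = lengthWeight q C n := by
  classical
  unfold lengthWeight
  have hinj : Function.Injective fun y : List (Fin m) × Fin m => y.1 ++ [y.2] := by
    rintro ⟨a, x⟩ ⟨b, y⟩ h
    simpa using h
  rw [← hinj.tsum_eq, ENNReal.tsum_prod']
  · refine tsum_congr fun w => ?_
    by_cases h : w.length = n ∧ C w
    · simp [h, tsum_fintype, ← Finset.mul_sum, hq]
    · simp [h]
  · intro w hw
    rcases List.eq_nil_or_concat w with rfl | ⟨a, x, rfl⟩
    · simp at hw
    · exact ⟨(a, x), by simp⟩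

theorem lengthWeight_add (C D : List (Fin m) → Prop) (hCD : ∀ w, C w → ¬ D w) (n : ℕ) :
    lengthWeight q C n + lengthWeight q D n = lengthWeight q (fun w => C w ∨ D w) n := by
  classical
  unfold lengthWeight
  rw [← ENNReal.tsum_add]
  refine tsum_congr fun w => ?_
  have := hCD w
  by_cases hC : C w <;> by_cases hD : D w <;> simp_all

theorem lengthWeight_dieZ_add (hq : ∑ i, q i = 1) {S : List (Fin m)} (hS : S ≠ []) (n : ℕ) :
    lengthWeight q (· ∈ dieZ S) (n + 1) + lengthWeight q (fun w => ¬ S <:+: w) (n + 1) =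
      lengthWeight q (fun w => ¬ S <:+: w) n := by
  rw [lengthWeight_add, ← lengthWeight_succ_dropLast hq (fun w => ¬ S <:+: w)]
  · congr 1
    ext w
    rw [mem_dieZ_iff hS]
    have : S <:+: w.dropLast → S <:+: w := fun h => h.trans (List.dropLast_prefix w).isInfix
    tauto
  · intro w hw
    rw [mem_dieZ_iff hS] at hw
    exact not_not.2 hw.1

theorem lengthWeight_avoid_le_one (hq : ∑ i, q i = 1) {S : List (Fin m)} (hS : S ≠ []) (n : ℕ) :
    lengthWeight q (fun w => ¬ S <:+: w) n ≤ 1 := by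
  induction n with
  | zero => exact lengthWeight_zero_le _
  | succ n ih => exact (le_add_self.trans (lengthWeight_dieZ_add hq hS n).le).trans ih

theorem lengthWeight_avoid_reverse (S : List (Fin m)) (n : ℕ) :
    lengthWeight q (fun w => ¬ S.reverse <:+: w) n = lengthWeight q (fun w => ¬ S <:+: w) n := by
  rw [← lengthWeight_reverse]
  simp only [List.reverse_infix]

theorem lengthWeight_dieZ_reverse (hq : ∑ i, q i = 1) {S : List (Fin m)} (hS : S ≠ []) (n : ℕ) :
    lengthWeight q (· ∈ dieZ S.reverse) (n + 1) = lengthWeight q (· ∈ dieZ S) (n + 1) := by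
  have h := lengthWeight_dieZ_add hq (S := S.reverse) (by simpa using hS) n
  rw [lengthWeight_avoid_reverse, lengthWeight_avoid_reverse, ← lengthWeight_dieZ_add hq hS n] at h
  exact (ENNReal.add_left_inj
    (ne_top_of_le_ne_top ENNReal.one_ne_top (lengthWeight_avoid_le_one hq hS _))).1 h

theorem tsum_nat_mul_lengthWeight (C : List (Fin m) → Prop) :
    ∑' n : ℕ, (n : ℝ≥0∞) * lengthWeight q C n =
      ∑' w : {w // C w}, (w.1.length : ℝ≥0∞) * (w.1.map q).prod := by
  classical
  unfold lengthWeight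
  simp_rw [← ENNReal.tsum_mul_left]
  rw [ENNReal.tsum_comm]
  refine Eq.trans ?_ (tsum_subtype {w | C w}
    fun w : List (Fin m) => (w.length : ℝ≥0∞) * (w.map q).prod).symm
  refine tsum_congr fun w => ?_
  rw [tsum_eq_single w.length fun n hn => by simp [hn.symm]]
  by_cases h : C w <;> simp [Set.indicator, h]

end lengthWeight

theorem dieE_eq_toReal_tsum {m : ℕ} {p : Fin m → ℝ} (hp : ∀ i, 0 ≤ p i) (S : List (Fin m)) :
    dieE p S = (∑' n : ℕ, (n : ℝ≥0∞) *
      lengthWeight (fun i => ENNReal.ofReal (p i)) (· ∈ dieZ S) n).toReal := by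
  have hprod (w : List (Fin m)) :
      ((w.map fun i => ENNReal.ofReal (p i)).prod) = ENNReal.ofReal (dieP p w) := by
    induction w with
    | nil => simp [dieP]
    | cons a w ih =>
      simp only [dieP, List.map_cons, List.prod_cons] at ih ⊢
      rw [ih, ENNReal.ofReal_mul (hp a)]
  have hnonneg (w : List (Fin m)) : 0 ≤ dieP p w :=
    List.prod_nonneg fun x hx => by
      obtain ⟨i, -, rfl⟩ := List.mem_map.1 hx
      exact hp i
  rw [tsum_nat_mul_lengthWeight, ENNReal.tsum_toReal_eq]
  · refine tsum_congr fun w => ?_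
    rw [hprod, ENNReal.toReal_mul, ENNReal.toReal_natCast, ENNReal.toReal_ofReal (hnonneg _)]
  · intro w
    rw [hprod]
    exact ENNReal.mul_ne_top (ENNReal.natCast_ne_top _) ENNReal.ofReal_ne_top

/-- `E(S') = E(S)` where `S'` is the reversal of `S`. -/
theorem stmt_14 (m : ℕ) (hm : 1 ≤ m) (p : Fin m → ℝ) (hp : ∀ i, 0 < p i)
    (hsum : ∑ i, p i = 1) (S : List (Fin m)) (hS : S ≠ []) :
    dieE p S.reverse = dieE p S := by
  have hq : ∑ i, ENNReal.ofReal (p i) = 1 := by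
    rw [← ENNReal.ofReal_sum_of_nonneg fun i _ => (hp i).le, hsum, ENNReal.ofReal_one]
  rw [dieE_eq_toReal_tsum fun i => (hp i).le, dieE_eq_toReal_tsum fun i => (hp i).le]
  congr 1
  refine tsum_congr fun n => ?_
  cases n with
  | zero => simp
  | succ n => rw [lengthWeight_dieZ_reverse hq hS]
end

section
/- Let S be a nonempty finite word over the alphabet [m]. Then for every integer n ≥ 1, the sum E(Y^n) := ∑_{w ∈ Z(S)} |w|^n · P(w) converges and E(Y^n) = ∑_{π ∈ Π_n} |π|! · ∏_{B ∈ π} ∑_{R ∈ overlap(S)} ((1 − |R|)^{|B|} − (−|R|)^{|B|}) / P(R), where Π_n is the set of all partitions of the set {1, …, n}, |π| is the number of blocks of π, and |B| is the size of a block B. -/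
/-- The set of all partitions of `{1, …, n}` (modeled as `Fin n`), each partition being
the finite set of its blocks: nonempty pairwise disjoint subsets covering `Fin n`
(every element lies in exactly one block). -/
noncomputable def setPartitions (n : ℕ) : Finset (Finset (Finset (Fin n))) := by
  classical
  exact Finset.univ.filter fun P =>
    (∀ B ∈ P, B.Nonempty) ∧ ∀ x : Fin n, ∃! B, B ∈ P ∧ x ∈ B

open Filter Topology

section SetPartitions

variable {α : Type*}

/-- The partitions of a finite set `s` into nonempty blocks. -/
noncomputable def partitionsOf (s : Finset α) : Finset (Finset (Finset α)) :=
  open Classical in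
  s.powerset.powerset.filter fun P =>
    (∀ B ∈ P, B.Nonempty) ∧ ∀ x ∈ s, ∃! B, B ∈ P ∧ x ∈ B

lemma mem_partitionsOf {s : Finset α} {P : Finset (Finset α)} :
    P ∈ partitionsOf s ↔ (∀ B ∈ P, B ⊆ s) ∧ (∀ B ∈ P, B.Nonempty) ∧
      ∀ x ∈ s, ∃! B, B ∈ P ∧ x ∈ B := by
  classical
  simp only [partitionsOf, Finset.mem_filter, Finset.mem_powerset]
  refine and_congr_left fun _ => ⟨fun h B hB => by simpa using h hB, fun h B hB => ?_⟩
  simpa using h B hB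

lemma setPartitions_eq (n : ℕ) : setPartitions n = partitionsOf (Finset.univ : Finset (Fin n)) := by
  classical
  ext P
  simp [setPartitions, mem_partitionsOf]

lemma partitionsOf_empty : partitionsOf (∅ : Finset α) = {∅} := by
  ext P
  rw [mem_partitionsOf, Finset.mem_singleton]
  constructor
  · rintro ⟨h1, h2, -⟩
    refine Finset.eq_empty_of_forall_notMem fun B hB => ?_
    obtain ⟨x, hx⟩ := h2 B hB
    exact absurd (h1 B hB hx) (by simp)
  · rintro rfl
    simp

variable [DecidableEq α]

lemma erase_mem_partitionsOf {s B : Finset α} {P : Finset (Finset α)} (hP : P ∈ partitionsOf s)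
    (hB : B ∈ P) : P.erase B ∈ partitionsOf (s \ B) := by
  rw [mem_partitionsOf] at hP ⊢
  obtain ⟨h1, h2, h3⟩ := hP
  refine ⟨fun C hC x hx => ?_, fun C hC => h2 C (Finset.mem_of_mem_erase hC), fun x hx => ?_⟩
  · rw [Finset.mem_erase] at hC
    refine Finset.mem_sdiff.2 ⟨h1 C hC.2 hx, fun hxB => hC.1 ?_⟩
    exact (h3 x (h1 C hC.2 hx)).unique ⟨hC.2, hx⟩ ⟨hB, hxB⟩
  · rw [Finset.mem_sdiff] at hx
    obtain ⟨C, hC, huniq⟩ := h3 x hx.1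
    refine ⟨C, ⟨Finset.mem_erase.2 ⟨fun h => hx.2 (h ▸ hC.2), hC.1⟩, hC.2⟩, fun D hD => ?_⟩
    exact huniq D ⟨Finset.mem_of_mem_erase hD.1, hD.2⟩

lemma insert_mem_partitionsOf {s B : Finset α} {P : Finset (Finset α)} (hBs : B ⊆ s)
    (hB : B.Nonempty) (hP : P ∈ partitionsOf (s \ B)) :
    B ∉ P ∧ insert B P ∈ partitionsOf s := by
  rw [mem_partitionsOf] at hP ⊢
  obtain ⟨h1, h2, h3⟩ := hP
  refine ⟨fun h => ?_, fun C hC => ?_, fun C hC => ?_, fun x hx => ?_⟩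
  · obtain ⟨x, hx⟩ := hB
    exact (Finset.mem_sdiff.1 (h1 B h hx)).2 hx
  · rcases Finset.mem_insert.1 hC with rfl | hC
    · exact hBs
    · exact (h1 C hC).trans Finset.sdiff_subset
  · rcases Finset.mem_insert.1 hC with rfl | hC
    · exact hB
    · exact h2 C hC
  · by_cases hxB : x ∈ B
    · refine ⟨B, ⟨Finset.mem_insert_self _ _, hxB⟩, fun C hC => ?_⟩
      rcases Finset.mem_insert.1 hC.1 with h | h
      · exact h
      · exact absurd hxB (Finset.mem_sdiff.1 (h1 C h hC.2)).2
    · obtain ⟨C, hC, huniq⟩ := h3 x (Finset.mem_sdiff.2 ⟨hx, hxB⟩)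
      refine ⟨C, ⟨Finset.mem_insert_of_mem hC.1, hC.2⟩, fun D hD => ?_⟩
      rcases Finset.mem_insert.1 hD.1 with h | h
      · exact absurd (h ▸ hD.2) hxB
      · exact huniq D ⟨h, hD.2⟩

/-- Choosing the first block of an ordered set partition. -/
lemma sum_partitionsOf_rec (a : ℕ → ℝ) (ha : a 0 = 0) {s : Finset α} (hs : s.Nonempty) :
    ∑ P ∈ partitionsOf s, (P.card.factorial : ℝ) * ∏ B ∈ P, a B.card =
      ∑ B ∈ s.powerset, a B.card *
        ∑ P ∈ partitionsOf (s \ B), (P.card.factorial : ℝ) * ∏ C ∈ P, a C.card := by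
  have h1 : ∑ P ∈ partitionsOf s, (P.card.factorial : ℝ) * ∏ B ∈ P, a B.card =
      ∑ P ∈ partitionsOf s, ∑ _B ∈ P, ((P.card - 1).factorial : ℝ) * ∏ B ∈ P, a B.card := by
    refine Finset.sum_congr rfl fun P hP => ?_
    have hne : P.card ≠ 0 := by
      obtain ⟨x, hx⟩ := hs
      obtain ⟨B, hB, -⟩ := (mem_partitionsOf.1 hP).2.2 x hx
      exact Finset.card_ne_zero_of_mem hB.1
    rw [Finset.sum_const, nsmul_eq_mul, ← mul_assoc, ← Nat.cast_mul, Nat.mul_factorial_pred hne]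
  have h2 : ∑ B ∈ s.powerset, a B.card *
        ∑ P ∈ partitionsOf (s \ B), (P.card.factorial : ℝ) * ∏ C ∈ P, a C.card =
      ∑ B ∈ s.powerset.filter (·.Nonempty), a B.card *
        ∑ P ∈ partitionsOf (s \ B), (P.card.factorial : ℝ) * ∏ C ∈ P, a C.card := by
    refine (Finset.sum_filter_of_ne fun B _ h => ?_).symm
    rw [Finset.nonempty_iff_ne_empty]
    rintro rfl
    simp [ha] at h
  rw [h1, h2, Finset.sum_sigma']
  simp_rw [Finset.mul_sum]
  rw [Finset.sum_sigma']
  refine Finset.sum_bij' (fun x _ => ⟨x.2, x.1.erase x.2⟩) (fun y _ => ⟨insert y.1 y.2, y.1⟩)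
    ?_ ?_ ?_ ?_ ?_
  · rintro ⟨P, B⟩ h
    simp only [Finset.mem_sigma, Finset.mem_filter, Finset.mem_powerset] at h ⊢
    have hP := mem_partitionsOf.1 h.1
    exact ⟨⟨hP.1 B h.2, hP.2.1 B h.2⟩, erase_mem_partitionsOf h.1 h.2⟩
  · rintro ⟨B, P⟩ h
    simp only [Finset.mem_sigma, Finset.mem_filter, Finset.mem_powerset] at h ⊢
    exact ⟨(insert_mem_partitionsOf h.1.1 h.1.2 h.2).2, Finset.mem_insert_self _ _⟩
  · rintro ⟨P, B⟩ h
    simp only [Finset.mem_sigma] at h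
    simp [Finset.insert_erase h.2]
  · rintro ⟨B, P⟩ h
    simp only [Finset.mem_sigma, Finset.mem_filter, Finset.mem_powerset] at h
    simp [Finset.erase_insert (insert_mem_partitionsOf h.1.1 h.1.2 h.2).1]
  · rintro ⟨P, B⟩ h
    simp only [Finset.mem_sigma] at h
    simp only [Finset.card_erase_of_mem h.2]
    rw [← Finset.mul_prod_erase P (fun B => a B.card) h.2]
    ring

lemma sum_partitionsOf_eq (a M : ℕ → ℝ) (ha : a 0 = 0) (hM0 : M 0 = 1)
    (hM : ∀ n, n ≠ 0 → M n = ∑ k ∈ Finset.range (n + 1), (n.choose k : ℝ) * (a k * M (n - k)))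
    (s : Finset α) :
    ∑ P ∈ partitionsOf s, (P.card.factorial : ℝ) * ∏ B ∈ P, a B.card = M s.card := by
  induction s using Finset.strongInduction with
  | H s ih =>
    rcases s.eq_empty_or_nonempty with rfl | hs
    · simp [partitionsOf_empty, hM0]
    rw [sum_partitionsOf_rec a ha hs, hM _ (Finset.card_ne_zero.2 hs)]
    have h : ∀ B ∈ s.powerset, a B.card *
        ∑ P ∈ partitionsOf (s \ B), (P.card.factorial : ℝ) * ∏ C ∈ P, a C.card =
        a B.card * M (s.card - B.card) := by
      intro B hB
      rw [Finset.mem_powerset] at hB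
      rcases B.eq_empty_or_nonempty with rfl | hBne
      · simp [ha]
      · rw [ih _ (Finset.sdiff_ssubset hB hBne), Finset.card_sdiff_of_subset hB]
    rw [Finset.sum_congr rfl h,
      Finset.sum_powerset_apply_card (fun k => a k * M (s.card - k))]
    simp [nsmul_eq_mul]

end SetPartitions

section Moments

lemma succ_pow_sub_pow_le (n : ℕ) {x : ℝ} (hx : 0 ≤ x) :
    (x + 1) ^ (n + 1) - x ^ (n + 1) ≤ (n + 1) * (x + 1) ^ n := by
  induction n with
  | zero => simp
  | succ n ih =>
    have h1 := mul_le_mul_of_nonneg_left ih hx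
    have h2 : 0 ≤ ((n : ℝ) + 1) * (x + 1) ^ n := by positivity
    push_cast
    have e : (x + 1) ^ (n + 1 + 1) - x ^ (n + 1 + 1) =
      (x + 1) ^ (n + 1) + x * ((x + 1) ^ (n + 1) - x ^ (n + 1)) := by ring
    have e2 : ((n : ℝ) + 1 + 1) * (x + 1) ^ (n + 1) =
      (x + 1) ^ (n + 1) + x * ((n + 1) * (x + 1) ^ n) + (n + 1) * (x + 1) ^ n := by ring
    linarith

variable {z q c : ℕ → ℝ} {O : Finset ℕ}

/-- Summation by parts for a law `z` with tail `q`. -/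
lemma sum_sub_mul_tail (hq0 : q 0 = 1) (hzq : ∀ k, q k = z (k + 1) + q (k + 1))
    (f : ℕ → ℝ) (N : ℕ) :
    ∑ k ∈ Finset.range N, (f (k + 1) - f k) * q k =
      f N * q N - f 0 + ∑ k ∈ Finset.range N, f (k + 1) * z (k + 1) := by
  induction N with
  | zero => simp [hq0]
  | succ N ih =>
    rw [Finset.sum_range_succ, Finset.sum_range_succ, ih]
    linear_combination (f (N + 1)) * hzq N

lemma summable_succ_pow_mul_tail (hz : ∀ k, 0 ≤ z k)
    (hqz : ∀ k, q k = ∑ i ∈ O, c i * z (k + (i + 1))) {n : ℕ}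
    (h : Summable fun k : ℕ => (k : ℝ) ^ n * z k) :
    Summable fun k : ℕ => ((k : ℝ) + 1) ^ n * q k := by
  have : (fun k : ℕ => ((k : ℝ) + 1) ^ n * q k) =
      fun k : ℕ => ∑ i ∈ O, c i * (((k : ℝ) + 1) ^ n * z (k + (i + 1))) := by
    funext k
    rw [hqz, Finset.mul_sum]
    exact Finset.sum_congr rfl fun i _ => by ring
  rw [this]
  refine summable_sum fun i _ => Summable.mul_left _ ?_
  refine Summable.of_nonneg_of_le (fun k => mul_nonneg (by positivity) (hz _)) (fun k => ?_)
    ((summable_nat_add_iff (i + 1)).2 h)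
  refine mul_le_mul_of_nonneg_right (pow_le_pow_left₀ (by positivity) ?_ _) (hz _)
  push_cast
  linarith [(Nat.cast_nonneg i : (0 : ℝ) ≤ i)]

lemma summable_pow_mul_law (hz : ∀ k, 0 ≤ z k) (hq : ∀ k, 0 ≤ q k)
    (hq0 : q 0 = 1) (hzq : ∀ k, q k = z (k + 1) + q (k + 1))
    (hqz : ∀ k, q k = ∑ i ∈ O, c i * z (k + (i + 1))) (n : ℕ) :
    Summable fun k : ℕ => (k : ℝ) ^ n * z k := by
  induction n with
  | zero =>
    rw [← summable_nat_add_iff 1]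
    refine summable_of_sum_range_le (c := 1) (fun k => mul_nonneg (by positivity) (hz _))
      fun N => ?_
    have h := sum_sub_mul_tail hq0 hzq (fun _ => 1) N
    have h' := hq N
    simp at h ⊢
    linarith
  | succ n ih =>
    have hs := (summable_succ_pow_mul_tail hz hqz ih).mul_left ((n : ℝ) + 1)
    rw [← summable_nat_add_iff 1]
    refine summable_of_sum_range_le (fun k => mul_nonneg (by positivity) (hz _)) fun N =>
      le_trans ?_ (hs.sum_le_tsum (Finset.range N) fun k _ => mul_nonneg (by positivity)
        (mul_nonneg (by positivity) (hq _)))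
    have h := sum_sub_mul_tail hq0 hzq (fun k => (k : ℝ) ^ (n + 1)) N
    have h' : 0 ≤ (N : ℝ) ^ (n + 1) * q N := mul_nonneg (by positivity) (hq N)
    have h2 : ∑ k ∈ Finset.range N, (((k + 1 : ℕ) : ℝ) ^ (n + 1) - (k : ℝ) ^ (n + 1)) * q k ≤
        ∑ k ∈ Finset.range N, ((n : ℝ) + 1) * (((k : ℝ) + 1) ^ n * q k) := by
      refine Finset.sum_le_sum fun k _ => ?_
      rw [← mul_assoc]
      refine mul_le_mul_of_nonneg_right ?_ (hq k)
      push_cast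
      exact succ_pow_sub_pow_le n (Nat.cast_nonneg k)
    simp only [Nat.cast_zero, zero_pow (Nat.succ_ne_zero n), sub_zero] at h
    linarith

lemma tendsto_pow_mul_tail (hz : ∀ k, 0 ≤ z k) (hq : ∀ k, 0 ≤ q k)
    (hq0 : q 0 = 1) (hzq : ∀ k, q k = z (k + 1) + q (k + 1))
    (hqz : ∀ k, q k = ∑ i ∈ O, c i * z (k + (i + 1))) (n : ℕ) :
    Tendsto (fun N : ℕ => (N : ℝ) ^ n * q N) atTop (𝓝 0) := by
  refine squeeze_zero (fun k => mul_nonneg (by positivity) (hq k)) (fun k => ?_)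
    (summable_succ_pow_mul_tail hz hqz
      (summable_pow_mul_law hz hq hq0 hzq hqz n)).tendsto_atTop_zero
  exact mul_le_mul_of_nonneg_right (pow_le_pow_left₀ (by positivity) (by linarith) _) (hq k)

lemma tendsto_sum_sub_mul_tail (hz : ∀ k, 0 ≤ z k) (hq : ∀ k, 0 ≤ q k) (hz0 : z 0 = 0)
    (hq0 : q 0 = 1) (hzq : ∀ k, q k = z (k + 1) + q (k + 1))
    (hqz : ∀ k, q k = ∑ i ∈ O, c i * z (k + (i + 1))) (n : ℕ) :
    Tendsto (fun N => ∑ k ∈ Finset.range N, (((k + 1 : ℕ) : ℝ) ^ n - (k : ℝ) ^ n) * q k) atTop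
      (𝓝 (∑' k : ℕ, (k : ℝ) ^ n * z k - 0 ^ n)) := by
  simp_rw [sum_sub_mul_tail hq0 hzq (fun k => (k : ℝ) ^ n)]
  have h1 := (summable_pow_mul_law hz hq hq0 hzq hqz n).hasSum
  have h2 := ((hasSum_nat_add_iff' 1).2 h1).tendsto_sum_nat
  have h3 := ((tendsto_pow_mul_tail hz hq hq0 hzq hqz n).sub_const (0 ^ n)).add h2
  simp only [Finset.sum_range_one, hz0, mul_zero, sub_zero] at h3
  convert h3 using 2
  · simp
  · ring

lemma tsum_law_eq_one (hz : ∀ k, 0 ≤ z k) (hq : ∀ k, 0 ≤ q k) (hz0 : z 0 = 0)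
    (hq0 : q 0 = 1) (hzq : ∀ k, q k = z (k + 1) + q (k + 1))
    (hqz : ∀ k, q k = ∑ i ∈ O, c i * z (k + (i + 1))) :
    ∑' k : ℕ, (k : ℝ) ^ 0 * z k = 1 := by
  have h := tendsto_sum_sub_mul_tail hz hq hz0 hq0 hzq hqz 0
  simp only [pow_zero, sub_self, zero_mul, Finset.sum_const_zero] at h
  have := tendsto_nhds_unique h tendsto_const_nhds
  simp only [pow_zero]
  linarith

lemma moment_rec (hz : ∀ k, 0 ≤ z k) (hq : ∀ k, 0 ≤ q k) (hz0 : z 0 = 0)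
    (hq0 : q 0 = 1) (hzq : ∀ k, q k = z (k + 1) + q (k + 1))
    (hqz : ∀ k, q k = ∑ i ∈ O, c i * z (k + (i + 1)))
    (hzO : ∀ i ∈ O, ∀ k ≤ i, z k = 0) (n : ℕ) (hn : n ≠ 0) :
    ∑' k : ℕ, (k : ℝ) ^ n * z k =
      ∑ l ∈ Finset.range (n + 1), (n.choose l : ℝ) *
        ((∑ i ∈ O, ((1 - ((i : ℝ) + 1)) ^ l - (-((i : ℝ) + 1)) ^ l) * c i) *
          ∑' k : ℕ, (k : ℝ) ^ (n - l) * z k) := by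
  have hM := fun n => (summable_pow_mul_law hz hq hq0 hzq hqz n).hasSum
  have key : ∀ i ∈ O, HasSum (fun k : ℕ => (((k + 1 : ℕ) : ℝ) ^ n - (k : ℝ) ^ n) *
      z (k + (i + 1))) (∑ l ∈ Finset.range (n + 1), ((n.choose l : ℝ) *
        ((1 - ((i : ℝ) + 1)) ^ l - (-((i : ℝ) + 1)) ^ l)) * ∑' k : ℕ, (k : ℝ) ^ (n - l) * z k) := by
    intro i hi
    have h1 := hasSum_sum (s := Finset.range (n + 1)) fun l _ => (hM (n - l)).mul_left
      ((n.choose l : ℝ) * ((1 - ((i : ℝ) + 1)) ^ l - (-((i : ℝ) + 1)) ^ l))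
    have h2 : ∀ j : ℕ, ∑ l ∈ Finset.range (n + 1),
        ((n.choose l : ℝ) * ((1 - ((i : ℝ) + 1)) ^ l - (-((i : ℝ) + 1)) ^ l)) *
          ((j : ℝ) ^ (n - l) * z j) =
        ((1 - ((i : ℝ) + 1) + j) ^ n - (-((i : ℝ) + 1) + j) ^ n) * z j := by
      intro j
      rw [add_pow, add_pow, ← Finset.sum_sub_distrib, Finset.sum_mul]
      exact Finset.sum_congr rfl fun l _ => by ring
    simp_rw [h2] at h1
    have h3 := (hasSum_nat_add_iff' (i + 1)).2 h1
    rw [Finset.sum_eq_zero (s := Finset.range (i + 1)) (fun k hk => by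
      rw [hzO i hi k (Nat.lt_succ_iff.1 (Finset.mem_range.1 hk)), mul_zero]), sub_zero] at h3
    refine h3.congr_fun fun k => ?_
    push_cast
    ring
  have h1 := (hasSum_sum fun i hi => (key i hi).mul_left (c i)).tendsto_sum_nat
  have h2 := tendsto_sum_sub_mul_tail hz hq hz0 hq0 hzq hqz n
  have h3 : ∀ k : ℕ, ∑ i ∈ O, c i * ((((k + 1 : ℕ) : ℝ) ^ n - (k : ℝ) ^ n) * z (k + (i + 1))) =
      (((k + 1 : ℕ) : ℝ) ^ n - (k : ℝ) ^ n) * q k := by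
    intro k
    rw [hqz, Finset.mul_sum]
    exact Finset.sum_congr rfl fun i _ => by ring
  simp_rw [h3] at h1
  have h4 := tendsto_nhds_unique h2 h1
  rw [zero_pow hn, sub_zero] at h4
  rw [h4]
  simp_rw [Finset.mul_sum, Finset.sum_mul, Finset.mul_sum]
  rw [Finset.sum_comm]
  exact Finset.sum_congr rfl fun l _ => Finset.sum_congr rfl fun i _ => by ring

end Moments

section Words

variable {m : ℕ}

lemma dieP_append (p : Fin m → ℝ) (u v : List (Fin m)) :
    dieP p (u ++ v) = dieP p u * dieP p v := by
  simp [dieP]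

lemma dieP_pos {p : Fin m → ℝ} (hp : ∀ i, 0 < p i) (w : List (Fin m)) : 0 < dieP p w :=
  List.prod_pos (by simpa using fun a _ => hp a)

lemma take_drop_eq_iff {S w : List (Fin m)} {i : ℕ} :
    (w.drop i).take S.length = S ↔ S <+: w.drop i :=
  List.prefix_iff_eq_take.trans eq_comm |>.symm

/-- The words ending with their only occurrence of `S` are those which contain `S`, but cease to
do so when their last letter is dropped. -/
lemma concat_mem_dieZ_iff {S u : List (Fin m)} {a : Fin m} (hS : S ≠ []) :
    u ++ [a] ∈ dieZ S ↔ S <:+: u ++ [a] ∧ ¬ S <:+: u := by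
  have hpos := List.length_pos_iff.2 hS
  have hocc : S <:+ u ++ [a] → (numOccs S (u ++ [a]) = 1 ↔ ¬ S <:+: u) := by
    rintro ⟨t, ht⟩
    have hlen : t.length + S.length = u.length + 1 := by
      simpa using congrArg List.length ht
    have ht' : ((u ++ [a]).drop t.length).take S.length = S := by simp [← ht]
    rw [numOccs, Finset.card_eq_one]
    constructor
    · rintro ⟨j, hj⟩ ⟨x, y, hxy⟩
      have h1 : t.length ∈ ({j} : Finset ℕ) := by
        rw [← hj, Finset.mem_filter, Finset.mem_range]
        exact ⟨by simp; omega, ht'⟩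
      have hl : x.length + S.length + y.length = u.length := by
        simpa [add_assoc] using congrArg List.length hxy
      have h2 : x.length ∈ ({j} : Finset ℕ) := by
        rw [← hj, Finset.mem_filter, Finset.mem_range]
        exact ⟨by simp; omega, by simp [← hxy]⟩
      rw [Finset.mem_singleton] at h1 h2
      omega
    · intro h
      refine ⟨t.length, Finset.eq_singleton_iff_unique_mem.2
        ⟨Finset.mem_filter.2 ⟨Finset.mem_range.2 (by simp; omega), ht'⟩, fun i hi => ?_⟩⟩
      rw [Finset.mem_filter] at hi
      have hl : S.length ≤ u.length + 1 - i := by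
        simpa using (take_drop_eq_iff.1 hi.2).length_le
      by_contra hne
      refine h ?_
      have hiu : i ≤ u.length := by omega
      have hpre : S <+: u.drop i := by
        have h3 := take_drop_eq_iff.1 hi.2
        rw [List.drop_append_of_le_length hiu] at h3
        exact List.prefix_of_prefix_length_le h3 (List.prefix_append _ _) (by simp; omega)
      exact hpre.isInfix.trans (List.drop_suffix i u).isInfix
  constructor
  · rintro ⟨h1, h2⟩
    exact ⟨h1.isInfix, (hocc h1).1 h2⟩
  · rintro ⟨h1, h2⟩
    have h3 : S <:+ u ++ [a] := (List.infix_concat_iff.1 h1).resolve_right h2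
    exact ⟨h3, (hocc h3).2 h2⟩

lemma not_infix_of_mem_dieZ {S w v : List (Fin m)} (hS : S ≠ []) (hw : w ∈ dieZ S)
    (hv : v <+: w) (hlt : v.length < w.length) : ¬ S <:+: v := by
  rcases w.eq_nil_or_concat' with rfl | ⟨u, a, rfl⟩
  · simp at hlt
  · have h : v <+: u := List.prefix_of_prefix_length_le hv (List.prefix_append _ _)
      (by simp at hlt; omega)
    exact fun hSv => ((concat_mem_dieZ_iff hS).1 hw).2 (hSv.trans h.isInfix)

/-- The words of a given length. -/
noncomputable def wordsOfLength (m k : ℕ) : Finset (List (Fin m)) :=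
  (List.finite_length_eq (Fin m) k).toFinset

@[simp] lemma mem_wordsOfLength {k : ℕ} {w : List (Fin m)} :
    w ∈ wordsOfLength m k ↔ w.length = k := by
  simp [wordsOfLength]

open Classical in
/-- The probability that `S` appears for the first time after exactly `k` rolls. -/
noncomputable def firstOccProb (p : Fin m → ℝ) (S : List (Fin m)) (k : ℕ) : ℝ :=
  ∑ w ∈ (wordsOfLength m k).filter (· ∈ dieZ S), dieP p w

open Classical in
/-- The probability that `S` does not appear within `k` rolls. -/
noncomputable def avoidProb (p : Fin m → ℝ) (S : List (Fin m)) (k : ℕ) : ℝ :=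
  ∑ w ∈ (wordsOfLength m k).filter (¬ S <:+: ·), dieP p w

lemma firstOccProb_nonneg {p : Fin m → ℝ} (hp : ∀ i, 0 < p i) (S : List (Fin m)) (k : ℕ) :
    0 ≤ firstOccProb p S k :=
  Finset.sum_nonneg fun w _ => (dieP_pos hp w).le

lemma avoidProb_nonneg {p : Fin m → ℝ} (hp : ∀ i, 0 < p i) (S : List (Fin m)) (k : ℕ) :
    0 ≤ avoidProb p S k :=
  Finset.sum_nonneg fun w _ => (dieP_pos hp w).le

lemma firstOccProb_of_lt (p : Fin m → ℝ) {S : List (Fin m)} {k : ℕ} (hk : k < S.length) :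
    firstOccProb p S k = 0 := by
  refine Finset.sum_eq_zero fun w hw => ?_
  simp only [Finset.mem_filter, mem_wordsOfLength] at hw
  have := hw.2.1.length_le
  omega

lemma avoidProb_zero (p : Fin m → ℝ) {S : List (Fin m)} (hS : S ≠ []) : avoidProb p S 0 = 1 := by
  classical
  have : (wordsOfLength m 0).filter (¬ S <:+: ·) = {[]} := by
    ext w
    simp only [Finset.mem_filter, mem_wordsOfLength, List.length_eq_zero_iff,
      Finset.mem_singleton, and_iff_left_iff_imp]
    rintro rfl
    simpa using hS
  rw [avoidProb, this]
  simp [dieP]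

lemma avoidProb_eq_add {p : Fin m → ℝ} (hsum : ∑ i, p i = 1) {S : List (Fin m)} (hS : S ≠ [])
    (k : ℕ) : avoidProb p S k = firstOccProb p S (k + 1) + avoidProb p S (k + 1) := by
  classical
  have h1 : avoidProb p S k = ∑ x ∈ (wordsOfLength m k).filter (¬ S <:+: ·) ×ˢ Finset.univ,
      dieP p (x.1 ++ [x.2]) := by
    rw [Finset.sum_product, avoidProb]
    refine Finset.sum_congr rfl fun w _ => ?_
    simp_rw [dieP_append]
    rw [← Finset.mul_sum]
    simp [dieP, hsum]
  rw [h1, firstOccProb, avoidProb, ← Finset.sum_union]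
  · refine Finset.sum_bij (fun x _ => x.1 ++ [x.2]) ?_ ?_ ?_ ?_
    · rintro ⟨w, a⟩ h
      simp only [Finset.mem_product, Finset.mem_filter, mem_wordsOfLength, Finset.mem_univ,
        and_true] at h
      simp only [Finset.mem_union, Finset.mem_filter, mem_wordsOfLength, List.length_append,
        List.length_singleton, h.1, true_and, concat_mem_dieZ_iff hS, h.2, not_false_iff, and_true]
      exact em _
    · rintro ⟨w, a⟩ _ ⟨w', a'⟩ _ h
      have := List.append_inj' h rfl
      simp_all
    · intro w hw
      rcases w.eq_nil_or_concat' with rfl | ⟨u, a, rfl⟩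
      · simp at hw
      · simp only [Finset.mem_union, Finset.mem_filter, mem_wordsOfLength, List.length_append,
          List.length_singleton, concat_mem_dieZ_iff hS, add_left_inj] at hw
        refine ⟨(u, a), ?_, rfl⟩
        simp only [Finset.mem_product, Finset.mem_filter, mem_wordsOfLength, Finset.mem_univ,
          and_true]
        rcases hw with hw | hw
        · exact ⟨hw.1, hw.2.2⟩
        · exact ⟨hw.1, fun h => hw.2 (h.trans (List.prefix_append _ _).isInfix)⟩
    · intro x _
      rfl
  · rw [Finset.disjoint_left]
    intro w h1 h2
    rw [Finset.mem_filter] at h1 h2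
    exact h2.2 h1.2.1.isInfix

lemma drop_eq_take_of_overlap {S w : List (Fin m)} {k i : ℕ} (hi : i ∈ overlapLens S)
    (hw : S <:+ w) (hk : w.length = k + (i + 1)) : w.drop k = S.take (i + 1) := by
  rw [overlapLens, Finset.mem_filter, Finset.mem_range] at hi
  have h := List.suffix_iff_eq_drop.1 (hi.2.trans hw)
  rw [h, List.length_take]
  congr 1
  omega

/-- Appending `S` to a word avoiding `S`, the first occurrence of `S` ends within the appended
copy, and meets it in an overlap of `S`. -/
lemma avoidProb_eq_sum {p : Fin m → ℝ} (hp : ∀ i, 0 < p i) {S : List (Fin m)} (hS : S ≠ [])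
    (k : ℕ) : avoidProb p S k =
      ∑ i ∈ overlapLens S, (dieP p (S.take (i + 1)))⁻¹ * firstOccProb p S (k + (i + 1)) := by
  classical
  simp_rw [firstOccProb, Finset.mul_sum]
  rw [Finset.sum_sigma', avoidProb]
  symm
  have hdecomp : ∀ x ∈ (overlapLens S).sigma
      (fun i => (wordsOfLength m (k + (i + 1))).filter (· ∈ dieZ S)),
      x.2.take k ++ S.take (x.1 + 1) = x.2 := by
    rintro ⟨i, w⟩ h
    simp only [Finset.mem_sigma, Finset.mem_filter, mem_wordsOfLength] at h
    have := List.take_append_drop k w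
    rwa [drop_eq_take_of_overlap h.1 h.2.2.1 h.2.1] at this
  refine Finset.sum_bij (fun x _ => x.2.take k) ?_ ?_ ?_ ?_
  · rintro ⟨i, w⟩ h
    simp only [Finset.mem_sigma, Finset.mem_filter, mem_wordsOfLength] at h ⊢
    refine ⟨by simp; omega, not_infix_of_mem_dieZ hS h.2.2 (List.take_prefix _ _) ?_⟩
    simp
    omega
  · have hle : ∀ x ∈ (overlapLens S).sigma
        (fun i => (wordsOfLength m (k + (i + 1))).filter (· ∈ dieZ S)),
        ∀ y ∈ (overlapLens S).sigma
        (fun i => (wordsOfLength m (k + (i + 1))).filter (· ∈ dieZ S)),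
        x.2.take k = y.2.take k → y.1 ≤ x.1 := by
      intro x hx y hy hxy
      by_contra hlt
      have hx2 := hdecomp x hx
      have hy2 := hdecomp y hy
      simp only [Finset.mem_sigma, Finset.mem_filter, mem_wordsOfLength] at hx hy
      refine not_infix_of_mem_dieZ hS hy.2.2 (v := x.2) ?_ (by omega) hx.2.2.1.isInfix
      rw [← hx2, ← hy2, hxy]
      exact (List.prefix_append_right_inj _).2 (List.take_prefix_take_left (by omega))
    rintro ⟨i, w⟩ hx ⟨j, v⟩ hy h
    have hij : i = j := le_antisymm (hle _ hy _ hx h.symm) (hle _ hx _ hy h)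
    subst hij
    have h1 := hdecomp _ hx
    have h2 := hdecomp _ hy
    dsimp only at h h1 h2
    rw [← h1, ← h2, h]
  · intro w hw
    simp only [Finset.mem_filter, mem_wordsOfLength] at hw
    have hpos := List.length_pos_iff.2 hS
    have hex : ∃ i, S <:+: w ++ S.take (i + 1) := by
      refine ⟨S.length, ?_⟩
      rw [List.take_of_length_le (by omega)]
      exact (List.suffix_append _ _).isInfix
    set i := Nat.find hex with hidef
    have hi : S <:+: w ++ S.take (i + 1) := Nat.find_spec hex
    have hiL : i < S.length := by
      have : i ≤ S.length - 1 := by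
        refine Nat.find_min' hex ?_
        rw [List.take_of_length_le (by omega)]
        exact (List.suffix_append _ _).isInfix
      omega
    have hprev : ¬ S <:+: w ++ S.take i := by
      rcases Nat.eq_zero_or_pos i with h0 | h0
      · simpa [h0] using hw.2
      · have := Nat.find_min hex (m := i - 1) (by omega)
        rwa [Nat.sub_add_cancel h0] at this
    have hZ : w ++ S.take (i + 1) ∈ dieZ S := by
      rw [← List.take_concat_get' S i hiL, ← List.append_assoc] at hi ⊢
      exact (concat_mem_dieZ_iff hS).2 ⟨hi, hprev⟩
    have hO : i ∈ overlapLens S := by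
      rw [overlapLens, Finset.mem_filter, Finset.mem_range]
      exact ⟨hiL, List.suffix_of_suffix_length_le (List.suffix_append _ _) hZ.1
        (by simp)⟩
    refine ⟨⟨i, w ++ S.take (i + 1)⟩, ?_, ?_⟩
    · simp only [Finset.mem_sigma, Finset.mem_filter, mem_wordsOfLength]
      exact ⟨hO, by simp; omega, hZ⟩
    · simp [← hw.1]
  · intro x hx
    rw [← hdecomp x hx, dieP_append]
    have hl : (x.2.take k).length = k := by
      simp only [Finset.mem_sigma, Finset.mem_filter, mem_wordsOfLength] at hx
      simp
      omega
    have h0 := (dieP_pos hp (S.take (x.1 + 1))).ne'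
    rw [List.take_left' hl]
    field_simp

/-- Grouping the words of `dieZ S` by length. -/
lemma hasSum_dieZ {p : Fin m → ℝ} (hp : ∀ i, 0 < p i) (S : List (Fin m)) (n : ℕ)
    (h : Summable fun k : ℕ => (k : ℝ) ^ n * firstOccProb p S k) :
    HasSum (fun w : dieZ S => (w.1.length : ℝ) ^ n * dieP p w.1)
      (∑' k : ℕ, (k : ℝ) ^ n * firstOccProb p S k) := by
  classical
  let e := Equiv.sigmaFiberEquiv fun w : dieZ S => w.1.length
  rw [← e.hasSum_iff]
  have hfib : ∀ k : ℕ, HasSum (fun w : {w : dieZ S // w.1.length = k} =>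
      (w.1.1.length : ℝ) ^ n * dieP p w.1.1) ((k : ℝ) ^ n * firstOccProb p S k) := by
    intro k
    let f : {w // w ∈ (wordsOfLength m k).filter (· ∈ dieZ S)} ≃
        {w : dieZ S // w.1.length = k} :=
      { toFun := fun w => ⟨⟨w.1, (Finset.mem_filter.1 w.2).2⟩,
          mem_wordsOfLength.1 (Finset.mem_filter.1 w.2).1⟩
        invFun := fun w => ⟨w.1.1, Finset.mem_filter.2 ⟨mem_wordsOfLength.2 w.2, w.1.2⟩⟩
        left_inv := fun _ => rfl
        right_inv := fun _ => rfl }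
    rw [← f.hasSum_iff, firstOccProb, Finset.mul_sum]
    refine (Finset.hasSum ((wordsOfLength m k).filter (· ∈ dieZ S))
      (fun w => (k : ℝ) ^ n * dieP p w)).congr_fun ?_
    intro w
    have := mem_wordsOfLength.1 (Finset.mem_filter.1 w.2).1
    simp [f, this]
  refine HasSum.sigma_of_hasSum h.hasSum hfib ?_
  refine (summable_sigma_of_nonneg fun x => ?_).2 ⟨fun k => (hfib k).summable, ?_⟩
  · exact mul_nonneg (by positivity) (dieP_pos hp _).le
  · exact h.congr fun k => (hfib k).tsum_eq.symm

end Words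

/-- Closed formula for the higher moments:
`E(Y^n) = ∑_{π ∈ Π_n} |π|! ∏_{B ∈ π} ∑_{R ∈ overlap(S)} ((1-|R|)^{|B|} - (-|R|)^{|B|})/P(R)`,
where the overlap of length `i + 1` (for `i ∈ overlapLens S`) is `S.take (i + 1)`. -/
theorem stmt_17 (m : ℕ) (hm : 1 ≤ m) (p : Fin m → ℝ) (hp : ∀ i, 0 < p i)
    (hsum : ∑ i, p i = 1) (S : List (Fin m)) (hS : S ≠ []) (n : ℕ) (hn : 1 ≤ n) :
    Summable (fun w : dieZ S => (w.1.length : ℝ) ^ n * dieP p w.1) ∧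
      ∑' w : dieZ S, (w.1.length : ℝ) ^ n * dieP p w.1 =
        ∑ π ∈ setPartitions n, (π.card.factorial : ℝ) *
          ∏ B ∈ π, ∑ i ∈ overlapLens S,
            ((1 - ((i : ℝ) + 1)) ^ B.card - (-((i : ℝ) + 1)) ^ B.card) /
              dieP p (S.take (i + 1)) := by
  have hz := firstOccProb_nonneg hp S
  have hq := avoidProb_nonneg hp S
  have hz0 : firstOccProb p S 0 = 0 := firstOccProb_of_lt p (List.length_pos_iff.2 hS)
  have hq0 := avoidProb_zero p hS
  have hzq := avoidProb_eq_add hsum hS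
  have hqz := avoidProb_eq_sum hp hS
  have hzO : ∀ i ∈ overlapLens S, ∀ k ≤ i, firstOccProb p S k = 0 := fun i hi k hk =>
    firstOccProb_of_lt p (hk.trans_lt (Finset.mem_range.1 (Finset.mem_filter.1 hi).1))
  have hs := hasSum_dieZ hp S n (summable_pow_mul_law hz hq hq0 hzq hqz n)
  refine ⟨hs.summable, ?_⟩
  rw [hs.tsum_eq, setPartitions_eq]
  have h := sum_partitionsOf_eq
    (fun l => ∑ i ∈ overlapLens S, ((1 - ((i : ℝ) + 1)) ^ l - (-((i : ℝ) + 1)) ^ l) *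
      (dieP p (S.take (i + 1)))⁻¹)
    (fun n => ∑' k : ℕ, (k : ℝ) ^ n * firstOccProb p S k) (by simp)
    (tsum_law_eq_one hz hq hz0 hq0 hzq hqz)
    (moment_rec hz hq hz0 hq0 hzq hqz hzO)
    (Finset.univ : Finset (Fin n))
  rw [Finset.card_univ, Fintype.card_fin] at h
  simpa only [div_eq_mul_inv] using h.symm
end
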